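/- The set of λ = (λ₁, …, λ_μ) ∈ ℝ^μ such that the polynomial h_λ(x) = x^μ + λ₁x^{μ-1} + ⋯ + λ_μ has exactly p negative simple real roots, exactly q positive simple real roots, no zero root, and no repeated complex roots, is a path-connected subset of ℝ^μ, for each fixed pair (p, q) with p + q ≤ μ and p + q ≡ μ (mod 2). -/

import Mathlib

open Polynomial

/-- The monic polynomial `h_λ(x) = x^μ + λ₁ x^(μ-1) + ⋯ + λ_μ`. -/
noncomputable def hpoly (μ : ℕ) (l : Fin μ → ℝ) : Polynomial ℝ :=
  X ^ μ + ∑ i : Fin μ, C (l i) * X ^ (μ - 1 - i.val)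

namespace RootConf

lemma sum_reflect (μ : ℕ) (g : ℕ → ℝ[X]) :
    ∑ i : Fin μ, g (μ - 1 - i.val) = ∑ i ∈ Finset.range μ, g i := by
  rw [Fin.sum_univ_eq_sum_range (fun i => g (μ - 1 - i)) μ, Finset.sum_range_reflect]

lemma hpoly_coeffs (μ : ℕ) (g : ℝ[X]) (hg : g.Monic) (hd : g.natDegree = μ) :
    hpoly μ (fun i => g.coeff (μ - 1 - i.val)) = g := by
  unfold hpoly
  rw [sum_reflect μ (fun k => C (g.coeff k) * X ^ k)]
  conv_rhs => rw [hg.as_sum, hd]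

lemma hpoly_coeff (μ : ℕ) (l : Fin μ → ℝ) (i : Fin μ) :
    (hpoly μ l).coeff (μ - 1 - i.val) = l i := by
  unfold hpoly
  have hi := i.2
  rw [coeff_add, coeff_X_pow, if_neg (by omega), zero_add, finsetSum_coeff,
    Finset.sum_eq_single i]
  · simp
  · intro j _ hj
    have hj2 := j.2
    have : j.val ≠ i.val := fun h => hj (Fin.ext h)
    rw [coeff_C_mul_X_pow, if_neg (by omega)]
  · simp

lemma hpoly_deg_aux (μ : ℕ) (l : Fin μ → ℝ) :
    (∑ i : Fin μ, C (l i) * X ^ (μ - 1 - i.val) : ℝ[X]).degree < μ := by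
  rw [degree_lt_iff_coeff_zero]
  intro m hm
  rw [finsetSum_coeff]
  refine Finset.sum_eq_zero fun j _ => ?_
  have hj2 := j.2
  rw [coeff_C_mul_X_pow, if_neg (by omega)]

lemma hpoly_monic (μ : ℕ) (l : Fin μ → ℝ) : (hpoly μ l).Monic :=
  monic_X_pow_add (hpoly_deg_aux μ l)

lemma hpoly_natDegree (μ : ℕ) (l : Fin μ → ℝ) : (hpoly μ l).natDegree = μ := by
  apply natDegree_eq_of_degree_eq_some
  unfold hpoly
  rw [degree_add_eq_left_of_degree_lt, degree_X_pow]
  rw [degree_X_pow]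
  exact hpoly_deg_aux μ l

abbrev Par (p q r : ℕ) := (Fin p → ℝ) × (Fin q → ℝ) × (Fin r → ℂ)

noncomputable def quad (z : ℂ) : ℝ[X] := X ^ 2 - C (2 * z.re) * X + C (z.re ^ 2 + z.im ^ 2)

noncomputable def G {p q r : ℕ} (x : Par p q r) : ℝ[X] :=
  (∏ i, (X - C (x.1 i))) * ((∏ i, (X - C (x.2.1 i))) * ∏ i, quad (x.2.2 i))

def PSet (p q r : ℕ) : Set (Par p q r) :=
  {x | ((∀ i j, i < j → x.1 i < x.1 j) ∧ ∀ i, x.1 i < 0) ∧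
    ((∀ i j, i < j → x.2.1 i < x.2.1 j) ∧ ∀ i, 0 < x.2.1 i) ∧
    (∀ i j, i < j → (x.2.2 i).re < (x.2.2 j).re ∨
      ((x.2.2 i).re = (x.2.2 j).re ∧ (x.2.2 i).im < (x.2.2 j).im)) ∧ ∀ i, 0 < (x.2.2 i).im}

lemma comb_lt {s t a b c d : ℝ} (hs : 0 ≤ s) (ht : 0 ≤ t) (hst : s + t = 1)
    (h1 : a < b) (h2 : c < d) : s * a + t * c < s * b + t * d := by
  rcases hs.eq_or_lt with rfl | hs
  · have : t = 1 := by linarith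
    subst this; linarith
  · have h3 := mul_lt_mul_of_pos_left h1 hs
    have h4 := mul_le_mul_of_nonneg_left h2.le ht
    linarith

lemma comb_lex {s t a b c d a' b' c' d' : ℝ} (hs : 0 ≤ s) (ht : 0 ≤ t) (hst : s + t = 1)
    (h1 : a < b ∨ (a = b ∧ a' < b')) (h2 : c < d ∨ (c = d ∧ c' < d')) :
    s * a + t * c < s * b + t * d ∨ (s * a + t * c = s * b + t * d ∧
      s * a' + t * c' < s * b' + t * d') := by
  rcases hs.eq_or_lt with rfl | hs
  · have : t = 1 := by linarith
    subst this; simpa using h2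
  rcases ht.eq_or_lt with rfl | ht
  · have : s = 1 := by linarith
    subst this; simpa using h1
  rcases h1 with h1 | ⟨rfl, h1⟩
  · left
    have h3 := mul_lt_mul_of_pos_left h1 hs
    have h5 : c ≤ d := by rcases h2 with h | h; exacts [h.le, h.1.le]
    have h4 := mul_le_mul_of_nonneg_left h5 ht.le
    linarith
  · rcases h2 with h2 | ⟨rfl, h2⟩
    · left
      have h3 := mul_lt_mul_of_pos_left h2 ht
      linarith
    · right
      exact ⟨rfl, comb_lt hs.le ht.le hst h1 h2⟩

lemma convex_PSet (p q r : ℕ) : Convex ℝ (PSet p q r) := by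
  rintro ⟨a, b, z⟩ ⟨⟨ha, ha'⟩, ⟨hb, hb'⟩, hz, hz'⟩ ⟨c, d, w⟩ ⟨⟨hc, hc'⟩, ⟨hd, hd'⟩, hw, hw'⟩
    s t hs ht hst
  refine ⟨⟨fun i j hij => ?_, fun i => ?_⟩, ⟨fun i j hij => ?_, fun i => ?_⟩,
    fun i j hij => ?_, fun i => ?_⟩
  · simpa using comb_lt hs ht hst (ha i j hij) (hc i j hij)
  · simpa using comb_lt hs ht hst (ha' i) (hc' i)
  · simpa using comb_lt hs ht hst (hb i j hij) (hd i j hij)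
  · simpa using comb_lt hs ht hst (hb' i) (hd' i)
  · simpa using comb_lex hs ht hst (hz i j hij) (hw i j hij)
  · simpa using comb_lt hs ht hst (hz' i) (hw' i)

lemma nonempty_PSet (p q r : ℕ) : (PSet p q r).Nonempty := by
  refine ⟨⟨fun i => (i.val : ℝ) - p, fun i => (i.val : ℝ) + 1, fun i => ⟨i.val, 1⟩⟩,
    ⟨fun i j hij => ?_, fun i => ?_⟩, ⟨fun i j hij => ?_, fun i => ?_⟩,
    fun i j hij => ?_, fun i => ?_⟩
  · simpa using hij
  · have := i.2
    simpa using this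
  · simpa using hij
  · simp only
    positivity
  · left; simpa using hij
  · simp

lemma cont_mul {T : Type*} [TopologicalSpace T] {f g : T → ℝ[X]}
    (hf : ∀ n, Continuous fun x => (f x).coeff n) (hg : ∀ n, Continuous fun x => (g x).coeff n)
    (n : ℕ) : Continuous fun x => (f x * g x).coeff n := by
  simp only [coeff_mul]
  exact continuous_finsetSum _ fun i _ => (hf _).mul (hg _)

lemma cont_prod {T ι : Type*} [TopologicalSpace T] (s : Finset ι) {f : ι → T → ℝ[X]}
    (hf : ∀ i n, Continuous fun x => (f i x).coeff n)
    (n : ℕ) : Continuous fun x => (∏ i ∈ s, f i x).coeff n := by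
  classical
  induction s using Finset.induction_on generalizing n with
  | empty => simpa using continuous_const
  | insert a s ha ih =>
    simp only [Finset.prod_insert ha]
    exact cont_mul (hf a) ih n

lemma cont_lin {T : Type*} [TopologicalSpace T] {f : T → ℝ} (hf : Continuous f) (n : ℕ) :
    Continuous fun x => (X - C (f x)).coeff n := by
  simp only [coeff_sub, coeff_C]
  split_ifs <;> fun_prop

lemma cont_quad {T : Type*} [TopologicalSpace T] {f : T → ℂ} (hf : Continuous f) (n : ℕ) :
    Continuous fun x => (quad (f x)).coeff n := by
  simp only [quad, coeff_sub, coeff_add, coeff_C, coeff_C_mul]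
  split_ifs <;> fun_prop

lemma cont_G {p q r : ℕ} (n : ℕ) : Continuous fun x : Par p q r => (G x).coeff n := by
  unfold G
  refine cont_mul (cont_prod _ fun i => cont_lin (by fun_prop))
    (cont_mul (cont_prod _ fun i => cont_lin (by fun_prop))
      (cont_prod _ fun i => cont_quad (by fun_prop))) n

lemma quad_eq (z : ℂ) : (quad z) = X ^ 2 + (C (-(2 * z.re)) * X + C (z.re ^ 2 + z.im ^ 2)) := by
  unfold quad
  rw [C_neg]; ring

lemma quad_monic (z : ℂ) : (quad z).Monic := by
  rw [quad_eq]
  exact monic_X_pow_add (n := 2) (lt_of_le_of_lt degree_linear_le (by norm_num))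

lemma quad_natDegree (z : ℂ) : (quad z).natDegree = 2 := by
  rw [quad_eq, ← add_assoc]
  have := natDegree_quadratic (R := ℝ) (a := 1) (b := -(2 * z.re)) (c := z.re ^ 2 + z.im ^ 2)
    one_ne_zero
  simpa using this

lemma quad_eval_pos (z : ℂ) (hz : 0 < z.im) (x : ℝ) : 0 < (quad z).eval x := by
  simp only [quad, eval_add, eval_sub, eval_mul, eval_pow, eval_X, eval_C]
  nlinarith [sq_nonneg (x - z.re), mul_pos hz hz]

lemma quad_map (z : ℂ) : (quad z).map (algebraMap ℝ ℂ) =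
    (X - C z) * (X - C ((starRingEnd ℂ) z)) := by
  have h1 : (algebraMap ℝ ℂ) (2 * z.re) = z + (starRingEnd ℂ) z := by
    rw [Complex.add_conj]; simp
  have h2 : (algebraMap ℝ ℂ) (z.re ^ 2 + z.im ^ 2) = z * (starRingEnd ℂ) z := by
    rw [Complex.mul_conj, Complex.normSq_apply]; simp [pow_two]
  simp only [quad, Polynomial.map_add, Polynomial.map_sub, Polynomial.map_mul, Polynomial.map_pow,
    map_X, map_C, h1, h2]
  rw [C_add, C_mul]
  ring

lemma G_monic {p q r : ℕ} (x : Par p q r) : (G x).Monic :=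
  (monic_prod_of_monic _ _ fun _ _ => monic_X_sub_C _).mul
    ((monic_prod_of_monic _ _ fun _ _ => monic_X_sub_C _).mul
      (monic_prod_of_monic _ _ fun _ _ => quad_monic _))

lemma G_natDegree {p q r : ℕ} (x : Par p q r) : (G x).natDegree = p + q + 2 * r := by
  unfold G
  rw [Monic.natDegree_mul, Monic.natDegree_mul, natDegree_prod_of_monic, natDegree_prod_of_monic,
    natDegree_prod_of_monic]
  · simp [quad_natDegree]; ring
  · exact fun _ _ => quad_monic _
  · exact fun _ _ => monic_X_sub_C _
  · exact fun _ _ => monic_X_sub_C _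
  · exact (monic_prod_of_monic _ _ fun _ _ => monic_X_sub_C _)
  · exact (monic_prod_of_monic _ _ fun _ _ => quad_monic _)
  · exact (monic_prod_of_monic _ _ fun _ _ => monic_X_sub_C _)
  · exact ((monic_prod_of_monic _ _ fun _ _ => monic_X_sub_C _).mul
      (monic_prod_of_monic _ _ fun _ _ => quad_monic _))

lemma roots_prod_lin {K : Type*} [Field K] {n : ℕ} (a : Fin n → K) :
    (∏ i, (X - C (a i))).roots = (Finset.univ : Finset (Fin n)).val.map a := by
  have := roots_multiset_prod_X_sub_C ((Finset.univ : Finset (Fin n)).val.map a)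
  rw [Multiset.map_map] at this
  exact this

lemma G_roots {p q r : ℕ} (x : Par p q r) (hx : x ∈ PSet p q r) :
    (G x).roots = (Finset.univ : Finset (Fin p)).val.map x.1 +
      (Finset.univ : Finset (Fin q)).val.map x.2.1 := by
  have h0 := (G_monic x).ne_zero
  unfold G at h0 ⊢
  rw [roots_mul h0, roots_mul (right_ne_zero_of_mul h0), roots_prod_lin, roots_prod_lin]
  have : (∏ i, quad (x.2.2 i)).roots = 0 := by
    rw [Multiset.eq_zero_iff_forall_notMem]
    intro y hy
    have := isRoot_of_mem_roots hy
    rw [IsRoot.def, eval_prod] at this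
    exact (Finset.prod_pos fun i _ => quad_eval_pos _ (hx.2.2.2 i) y).ne' this
  rw [this, add_zero]

lemma G_map {p q r : ℕ} (x : Par p q r) : (G x).map (algebraMap ℝ ℂ) =
    (∏ i, (X - C ((x.1 i : ℝ) : ℂ))) * ((∏ i, (X - C ((x.2.1 i : ℝ) : ℂ))) *
      ((∏ i, (X - C (x.2.2 i))) * ∏ i, (X - C ((starRingEnd ℂ) (x.2.2 i))))) := by
  unfold G
  rw [← Finset.prod_mul_distrib]
  simp [Polynomial.map_prod, quad_map]

lemma G_map_roots {p q r : ℕ} (x : Par p q r) : ((G x).map (algebraMap ℝ ℂ)).roots =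
    (Finset.univ : Finset (Fin p)).val.map (fun i => ((x.1 i : ℝ) : ℂ)) +
    ((Finset.univ : Finset (Fin q)).val.map (fun i => ((x.2.1 i : ℝ) : ℂ)) +
    ((Finset.univ : Finset (Fin r)).val.map x.2.2 +
    (Finset.univ : Finset (Fin r)).val.map (fun i => (starRingEnd ℂ) (x.2.2 i)))) := by
  have h0 := ((G_monic x).map (algebraMap ℝ ℂ)).ne_zero
  rw [G_map] at h0 ⊢
  have h1 := right_ne_zero_of_mul h0
  have h2 := right_ne_zero_of_mul h1
  rw [roots_mul h0, roots_mul h1, roots_mul h2, roots_prod_lin, roots_prod_lin, roots_prod_lin,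
    roots_prod_lin]

lemma inj_of_lt {n : ℕ} {α : Type*} {f : Fin n → α} (h : ∀ i j, i < j → f i ≠ f j) :
    Function.Injective f := by
  intro i j hij
  rcases lt_trichotomy i j with h1 | h1 | h1
  · exact absurd hij (h i j h1)
  · exact h1
  · exact absurd hij.symm (h j i h1)

lemma G_nodup {p q r : ℕ} (x : Par p q r) (hx : x ∈ PSet p q r) :
    ((G x).map (algebraMap ℝ ℂ)).roots.Nodup := by
  obtain ⟨⟨ha, ha'⟩, ⟨hb, hb'⟩, hz, hz'⟩ := hx
  have hzi : Function.Injective x.2.2 := inj_of_lt fun i j hij h => by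
    have := hz i j hij
    rw [h] at this
    simp at this
  rw [G_map_roots]
  simp only [Multiset.nodup_add, Multiset.disjoint_left]
  refine ⟨Finset.univ.nodup.map (inj_of_lt fun i j hij h => (ha i j hij).ne (by simpa using h)),
    ⟨Finset.univ.nodup.map (inj_of_lt fun i j hij h => (hb i j hij).ne (by simpa using h)),
    ⟨Finset.univ.nodup.map hzi,
      Finset.univ.nodup.map ((starRingEnd ℂ).injective.comp hzi), ?_⟩, ?_⟩, ?_⟩
  · intro c h1 h2
    simp only [Multiset.mem_map, Finset.mem_val, Finset.mem_univ, true_and] at h1 h2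
    obtain ⟨i, rfl⟩ := h1
    obtain ⟨j, h⟩ := h2
    have := congrArg Complex.im h
    have h3 := hz' i
    have h4 := hz' j
    simp at this
    linarith
  · intro c h1 h2
    simp only [Multiset.mem_add, Multiset.mem_map, Finset.mem_val, Finset.mem_univ, true_and] at h1 h2
    obtain ⟨i, rfl⟩ := h1
    rcases h2 with ⟨j, h⟩ | ⟨j, h⟩ <;>
    · have := congrArg Complex.im h
      have h4 := hz' j
      simp at this
      linarith
  · intro c h1 h2
    simp only [Multiset.mem_add, Multiset.mem_map, Finset.mem_val, Finset.mem_univ, true_and] at h1 h2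
    obtain ⟨i, rfl⟩ := h1
    rcases h2 with ⟨j, h⟩ | ⟨j, h⟩ | ⟨j, h⟩
    · have := congrArg Complex.re h
      have h4 := hb' j
      have h3 := ha' i
      simp at this
      linarith
    all_goals
      have := congrArg Complex.im h
      have h4 := hz' j
      simp at this
      linarith

lemma filter_map_all {n : ℕ} (a : Fin n → ℝ) (P : ℝ → Prop) [DecidablePred P] (h : ∀ i, P (a i)) :
    ((Finset.univ : Finset (Fin n)).val.map a).filter P = (Finset.univ : Finset (Fin n)).val.map a := by
  rw [Multiset.filter_eq_self]
  intro y hy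
  obtain ⟨i, _, rfl⟩ := Multiset.mem_map.1 hy
  exact h i

lemma filter_map_none {n : ℕ} (a : Fin n → ℝ) (P : ℝ → Prop) [DecidablePred P]
    (h : ∀ i, ¬ P (a i)) :
    ((Finset.univ : Finset (Fin n)).val.map a).filter P = 0 := by
  rw [Multiset.filter_eq_nil]
  intro y hy
  obtain ⟨i, _, rfl⟩ := Multiset.mem_map.1 hy
  exact h i

/-- Enumerate a finset of complex numbers in lexicographic order. -/
lemma exists_lex_enum (U : Finset ℂ) (r : ℕ) (hU : U.card = r) :
    ∃ z : Fin r → ℂ, (∀ i j, i < j → (z i).re < (z j).re ∨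
      ((z i).re = (z j).re ∧ (z i).im < (z j).im)) ∧ Finset.univ.image z = U := by
  classical
  let e : ℂ ≃ ℝ ×ₗ ℝ := Complex.equivRealProd.trans toLex
  let V : Finset (ℝ ×ₗ ℝ) := U.map e.toEmbedding
  have hV : V.card = r := by simp [V, hU]
  refine ⟨fun i => e.symm (V.orderEmbOfFin hV i), fun i j hij => ?_, ?_⟩
  · have := (V.orderEmbOfFin hV).strictMono hij
    rw [Prod.Lex.lt_iff] at this
    exact this
  · ext c
    have h1 := Finset.range_orderEmbOfFin V hV
    have h2 : e c ∈ (V : Set _) ↔ c ∈ U := by simp [V]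
    have h3 : e c ∈ Set.range (V.orderEmbOfFin hV) ↔ c ∈ U := by rw [h1]; exact h2
    rw [← h3]
    simp only [Finset.mem_image, Finset.mem_univ, true_and, Equiv.symm_apply_eq, Set.mem_range]

lemma exists_enum (U : Finset ℝ) (r : ℕ) (hU : U.card = r) :
    ∃ z : Fin r → ℝ, (∀ i j, i < j → z i < z j) ∧ Finset.univ.image z = U := by
  classical
  refine ⟨U.orderEmbOfFin hU, fun i j hij => (U.orderEmbOfFin hU).strictMono hij, ?_⟩
  ext c
  rw [← Finset.mem_coe (s := U), ← Finset.range_orderEmbOfFin U hU]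
  simp

/-- Any admissible polynomial comes from a parameter. -/
lemma exists_param (p q r : ℕ) (f : ℝ[X]) (hf : f.Monic) (hd : f.natDegree = p + q + 2 * r)
    (hp : Multiset.card (f.roots.filter (fun x => x < 0)) = p)
    (hq : Multiset.card (f.roots.filter (fun x => 0 < x)) = q)
    (h0 : f.eval 0 ≠ 0) (hn : (f.map (algebraMap ℝ ℂ)).roots.Nodup) :
    ∃ x ∈ PSet p q r, G x = f := by
  classical
  have hfm := hf.map (algebraMap ℝ ℂ)
  have hnr : f.roots.Nodup :=
    Multiset.Nodup.of_map _ (Multiset.nodup_of_le (map_roots_le hfm.ne_zero) hn)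
  let A : Finset ℝ := ⟨f.roots.filter (fun x => x < 0), hnr.filter _⟩
  let B : Finset ℝ := ⟨f.roots.filter (fun x => 0 < x), hnr.filter _⟩
  let R : Finset ℂ := ⟨(f.map (algebraMap ℝ ℂ)).roots, hn⟩
  let U : Finset ℂ := R.filter (fun z => 0 < z.im)
  have hmem : ∀ z : ℂ, z ∈ R ↔ f.aeval z = 0 := fun z => by
    change z ∈ (f.map (algebraMap ℝ ℂ)).roots ↔ _
    rw [mem_roots hfm.ne_zero, IsRoot.def, eval_map_algebraMap]
  have hmemr : ∀ y : ℝ, y ∈ f.roots ↔ f.eval y = 0 := fun y => by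
    rw [mem_roots hf.ne_zero, IsRoot.def]
  have hA : ∀ y, y ∈ A ↔ f.eval y = 0 ∧ y < 0 := fun y => by
    change y ∈ f.roots.filter _ ↔ _
    rw [Multiset.mem_filter, hmemr]
  have hB : ∀ y, y ∈ B ↔ f.eval y = 0 ∧ 0 < y := fun y => by
    change y ∈ f.roots.filter _ ↔ _
    rw [Multiset.mem_filter, hmemr]
  have hU : ∀ z, z ∈ U ↔ f.aeval z = 0 ∧ 0 < z.im := fun z => by
    rw [Finset.mem_filter, hmem]
  have hreal : ∀ y : ℝ, f.aeval (y : ℂ) = 0 ↔ f.eval y = 0 := fun y => by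
    have : f.aeval (y : ℂ) = ((f.eval y : ℝ) : ℂ) := by
      rw [← Complex.coe_algebraMap, aeval_algebraMap_apply, coe_aeval_eq_eval]
    rw [this, Complex.ofReal_eq_zero]
  have hconj : ∀ z : ℂ, f.aeval ((starRingEnd ℂ) z) = 0 ↔ f.aeval z = 0 := fun z => by
    rw [aeval_conj, map_eq_zero]
  obtain ⟨a, ha, ha2⟩ := exists_enum A p hp
  obtain ⟨b, hb, hb2⟩ := exists_enum B q hq
  obtain ⟨z, hz, hz2⟩ := exists_lex_enum U U.card rfl
  have hmA : ∀ i, a i ∈ A := fun i => ha2 ▸ Finset.mem_image_of_mem _ (Finset.mem_univ i)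
  have hmB : ∀ i, b i ∈ B := fun i => hb2 ▸ Finset.mem_image_of_mem _ (Finset.mem_univ i)
  have hmU : ∀ i, z i ∈ U := fun i => by
    have := Finset.mem_image_of_mem z (Finset.mem_univ i)
    rwa [hz2] at this
  let x : Par p q U.card := ⟨a, b, z⟩
  have hx : x ∈ PSet p q U.card :=
    ⟨⟨ha, fun i => ((hA _).1 (hmA i)).2⟩, ⟨hb, fun i => ((hB _).1 (hmB i)).2⟩, hz,
      fun i => ((hU _).1 (hmU i)).2⟩
  have hroots : ((G x).map (algebraMap ℝ ℂ)).roots = (f.map (algebraMap ℝ ℂ)).roots := by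
    rw [Multiset.Nodup.ext (G_nodup x hx) hn]
    intro c
    change _ ↔ c ∈ R
    rw [hmem, G_map_roots]
    simp only [Multiset.mem_add, Multiset.mem_map, Finset.mem_val, Finset.mem_univ, true_and]
    constructor
    · rintro (⟨i, rfl⟩ | ⟨i, rfl⟩ | ⟨i, rfl⟩ | ⟨i, rfl⟩)
      · exact (hreal _).2 ((hA _).1 (hmA i)).1
      · exact (hreal _).2 ((hB _).1 (hmB i)).1
      · exact ((hU _).1 (hmU i)).1
      · exact (hconj _).2 ((hU _).1 (hmU i)).1
    · intro hc
      rcases lt_trichotomy c.im 0 with him | him | him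
      · have : (starRingEnd ℂ) c ∈ U := (hU _).2 ⟨(hconj _).2 hc, by simpa using him⟩
        rw [← hz2] at this
        obtain ⟨i, _, hi⟩ := Finset.mem_image.1 this
        exact Or.inr (Or.inr (Or.inr ⟨i, by simp [x, hi]⟩))
      · have hcr : c = ((c.re : ℝ) : ℂ) := Complex.ext (by simp) (by simpa using him)
        have hcr2 : f.eval c.re = 0 := by rw [← hreal, ← hcr]; exact hc
        rcases lt_trichotomy c.re 0 with hre | hre | hre
        · have : c.re ∈ A := (hA _).2 ⟨hcr2, hre⟩
          rw [← ha2] at this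
          obtain ⟨i, _, hi⟩ := Finset.mem_image.1 this
          exact Or.inl ⟨i, by rw [hcr, ← hi]⟩
        · rw [hre] at hcr2
          exact absurd hcr2 h0
        · have : c.re ∈ B := (hB _).2 ⟨hcr2, hre⟩
          rw [← hb2] at this
          obtain ⟨i, _, hi⟩ := Finset.mem_image.1 this
          exact Or.inr (Or.inl ⟨i, by rw [hcr, ← hi]⟩)
      · have : c ∈ U := (hU _).2 ⟨hc, him⟩
        rw [← hz2] at this
        obtain ⟨i, _, hi⟩ := Finset.mem_image.1 this
        exact Or.inr (Or.inr (Or.inl ⟨i, hi⟩))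
  have hGf : G x = f := by
    apply map_injective _ (algebraMap ℝ ℂ).injective
    rw [(IsAlgClosed.splits ((G x).map (algebraMap ℝ ℂ))).eq_prod_roots_of_monic
      ((G_monic x).map _), (IsAlgClosed.splits (f.map (algebraMap ℝ ℂ))).eq_prod_roots_of_monic
      hfm, hroots]
  have hcard : U.card = r := by
    have := G_natDegree x
    rw [hGf, hd] at this
    omega
  exact hcard ▸ ⟨x, hx, hGf⟩

end RootConf

open RootConf

/-- For fixed `(p, q)` with `p + q ≤ μ` and `p + q ≡ μ (mod 2)`, the set of parameters
`λ ∈ ℝ^μ` such that `h_λ` has exactly `p` negative simple real roots, exactly `q`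
positive simple real roots, no zero root and no repeated complex roots, is
path-connected. -/
theorem pathConnected_root_configuration (μ p q : ℕ)
    (hpq : p + q ≤ μ) (hpar : (p + q) % 2 = μ % 2) :
    IsPathConnected {l : Fin μ → ℝ |
      Multiset.card ((hpoly μ l).roots.filter (fun x => x < 0)) = p ∧
      Multiset.card ((hpoly μ l).roots.filter (fun x => 0 < x)) = q ∧
      (hpoly μ l).eval 0 ≠ 0 ∧
      ((hpoly μ l).map (algebraMap ℝ ℂ)).roots.Nodup} := by
  obtain ⟨r, hr⟩ : ∃ r, μ = p + q + 2 * r := ⟨(μ - (p + q)) / 2, by omega⟩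
  have key := ((convex_PSet p q r).isPathConnected (nonempty_PSet p q r)).image
    (f := fun x : Par p q r => fun i : Fin μ => (G x).coeff (μ - 1 - i.val))
    (continuous_pi fun i => cont_G _)
  convert key using 1
  ext l
  constructor
  · rintro ⟨h1, h2, h3, h4⟩
    obtain ⟨x, hx, hG⟩ := exists_param p q r _ (hpoly_monic μ l)
      ((hpoly_natDegree μ l).trans hr) h1 h2 h3 h4
    refine ⟨x, hx, ?_⟩
    funext i
    simp only [hG, hpoly_coeff]
  · rintro ⟨x, hx, rfl⟩
    have hG := hpoly_coeffs μ (G x) (G_monic x) ((G_natDegree x).trans hr.symm)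
    simp only [Set.mem_setOf_eq, hG]
    obtain ⟨⟨ha, ha'⟩, ⟨hb, hb'⟩, hz, hz'⟩ := id hx
    refine ⟨?_, ?_, ?_, G_nodup x hx⟩
    · rw [G_roots x hx, Multiset.filter_add, filter_map_all _ _ ha',
        filter_map_none _ _ fun i => (hb' i).not_gt]
      simp
    · rw [G_roots x hx, Multiset.filter_add, filter_map_all _ _ hb',
        filter_map_none _ _ fun i => (ha' i).not_gt]
      simp
    · intro h
      have : (0 : ℝ) ∈ (G x).roots := (mem_roots (G_monic x).ne_zero).2 h
      rw [G_roots x hx] at this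
      simp only [Multiset.mem_add, Multiset.mem_map, Finset.mem_val, Finset.mem_univ,
        true_and] at this
      rcases this with ⟨i, hi⟩ | ⟨i, hi⟩
      · exact (ha' i).ne hi
      · exact (hb' i).ne' hi
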